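/- Let M be a d-dimensional finitely generated R-module. The following are equivalent: (1) M is sequentially Cohen-Macaulay; (2) δ_i(M) and M/δ_i(M) are sequentially Cohen-Macaulay for all i ∈ {0,…,d}; (3) there exists i ∈ {0,…,d} such that δ_i(M) and M/δ_i(M) are sequentially Cohen-Macaulay. In particular, M is sequentially Cohen-Macaulay if and only if M/H^0_m(M) is sequentially Cohen-Macaulay. -/

import Mathlib

open CategoryTheory

noncomputable section

/-- The (Krull) dimension of a module: the Krull dimension of its support.
The dimension of the zero module is `⊥` (thought of as `-1`). -/
noncomputable def mDim (R : Type) [CommRing R] (M : Type) [AddCommGroup M] [Module R M] :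
    WithBot ℕ∞ :=
  Order.krullDim (Module.support R M)

/-- The `i`-th Ext module `Ext_R^i(A, B)` (as a type). -/
noncomputable abbrev extC (R : Type) [CommRing R] (i : ℕ) (A B : Type)
    [AddCommGroup A] [Module R A] [AddCommGroup B] [Module R B] : Type :=
  ↥(((Ext R (ModuleCat R) i).obj (Opposite.op (ModuleCat.of R A))).obj (ModuleCat.of R B))

/-- The depth of a module `M` with respect to an ideal `I`:
the least `i` such that `Ext_R^i(R/I, M) ≠ 0` (and `⊤` if there is no such `i`,
in particular the depth of the zero module is `⊤ = +∞`). -/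
noncomputable def mDepth (R : Type) [CommRing R] (I : Ideal R) (M : Type)
    [AddCommGroup M] [Module R M] : ℕ∞ :=
  sInf {i : ℕ∞ | ∃ j : ℕ, i = j ∧ Nontrivial (extC R j (R ⧸ I) M)}

/-- `M` is a Cohen-Macaulay module (with respect to the (maximal) ideal `I`) if it is
nonzero and its depth equals its dimension. -/
def IsCM (R : Type) [CommRing R] (I : Ideal R) (M : Type) [AddCommGroup M] [Module R M] :
    Prop :=
  Nontrivial M ∧ (mDepth R I M : WithBot ℕ∞) = mDim R M

/-- The subquotient `N'/N` of a module (most meaningful when `N ≤ N'`). -/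
abbrev subQuot (R : Type) [CommRing R] {M : Type} [AddCommGroup M] [Module R M]
    (N N' : Submodule R M) : Type :=
  N' ⧸ (Submodule.comap N'.subtype N)

/-- `F 0 = 0 ⊊ F 1 ⊊ ⋯ ⊊ F r = M` is a sCM filtration: each quotient `F (i+1) / F i`
is Cohen-Macaulay and the dimensions of the quotients are strictly increasing. -/
def IsSCMFil (R : Type) [CommRing R] (I : Ideal R) {M : Type} [AddCommGroup M] [Module R M]
    (r : ℕ) (F : ℕ → Submodule R M) : Prop :=
  F 0 = ⊥ ∧ F r = ⊤ ∧ (∀ i < r, F i < F (i + 1)) ∧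
    (∀ i < r, IsCM R I (subQuot R (F i) (F (i + 1)))) ∧
    (∀ i, i + 1 < r →
      mDim R (subQuot R (F i) (F (i + 1))) < mDim R (subQuot R (F (i + 1)) (F (i + 2))))

/-- `M` is sequentially Cohen-Macaulay if it admits a sCM filtration. -/
def IsSeqCM (R : Type) [CommRing R] (I : Ideal R) (M : Type) [AddCommGroup M] [Module R M] :
    Prop :=
  ∃ (r : ℕ) (F : ℕ → Submodule R M), IsSCMFil R I r F

/-- `δ_c(M)`: the largest submodule of `M` of dimension at most `c`. -/
noncomputable def deltaSub (R : Type) [CommRing R] (M : Type) [AddCommGroup M] [Module R M]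
    (c : ℕ) : Submodule R M :=
  sSup {N : Submodule R M | mDim R ↥N ≤ (c : WithBot ℕ∞)}

/-- `δ_{c-1}(M)`, with `δ_{-1}(M) = 0`. -/
noncomputable def deltaSubPred (R : Type) [CommRing R] (M : Type) [AddCommGroup M] [Module R M] :
    ℕ → Submodule R M
  | 0 => ⊥
  | (c + 1) => deltaSub R M c

/-- `H^0_I(M)`, the `I`-power-torsion submodule of `M`. -/
noncomputable def tors (R : Type) [CommRing R] (I : Ideal R) (M : Type) [AddCommGroup M]
    [Module R M] : Submodule R M :=
  ⨆ t : ℕ, Submodule.torsionBySet R M ((I ^ t : Ideal R) : Set R)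

end

lemma ext_trivial_iff (R : Type) [CommRing R] {X : ModuleCat R} (P : ProjectiveResolution X) (n : ℕ) (Y : ModuleCat R) :
    Subsingleton ↥(((Ext R (ModuleCat R) n).obj (Opposite.op X)).obj Y) ↔
    ∀ f : P.complex.X n ⟶ Y, P.complex.d (n+1) n ≫ f = 0 → ∃ g : P.complex.X (n-1) ⟶ Y,
      P.complex.d n (n-1) ≫ g = f := by
  rw [← ModuleCat.isZero_iff_subsingleton, (P.isoExt n Y).isZero_iff,
    ← HomologicalComplex.exactAt_iff_isZero_homology,
    HomologicalComplex.exactAt_iff' _ (n-1) n (n+1) (by cases n <;> simp) (by simp),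
    ShortComplex.moduleCat_exact_iff]
  rfl

lemma ext_ses (R : Type) [CommRing R] {X : ModuleCat R} (P : ProjectiveResolution X) (n : ℕ)
    (S : ShortComplex (ModuleCat R)) (hS : S.ShortExact)
    (h1 : Subsingleton ↥(((Ext R (ModuleCat R) (n+1)).obj (Opposite.op X)).obj S.X₁))
    (h2 : Subsingleton ↥(((Ext R (ModuleCat R) n).obj (Opposite.op X)).obj S.X₂)) :
    Subsingleton ↥(((Ext R (ModuleCat R) n).obj (Opposite.op X)).obj S.X₃) := by
  rw [ext_trivial_iff R P] at *
  intro f hf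
  have := hS.epi_g
  have := hS.mono_f
  have hproj := P.projective n
  have hproj := P.projective (n+1)
  obtain ⟨g, hg⟩ : ∃ g, g ≫ S.g = f := ⟨Projective.factorThru f S.g, by simp⟩
  have h0 : (P.complex.d (n+1) n ≫ g) ≫ S.g = 0 := by rw [Category.assoc, hg, hf]
  have hh := hS.exact.lift_f _ h0
  set h := hS.exact.lift _ h0
  obtain ⟨h', e'⟩ : ∃ h' : P.complex.X n ⟶ S.X₁, P.complex.d (n+1) n ≫ h' = h :=
    h1 h (by rw [← cancel_mono S.f]; simp [hh])
  obtain ⟨e, he⟩ := h2 (g - h' ≫ S.f) (by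
    rw [Preadditive.comp_sub, ← Category.assoc, e', hh, sub_self])
  refine ⟨e ≫ S.g, ?_⟩
  rw [← Category.assoc, he, Preadditive.sub_comp, Category.assoc, S.zero, hg]
  simp
lemma ext_zero (R : Type) [CommRing R] {X Y : ModuleCat R} (P : ProjectiveResolution X) 
    (h1 : Subsingleton ↥(((Ext R (ModuleCat R) 0).obj (Opposite.op X)).obj Y)) (f : X ⟶ Y) : f = 0 := by
  rw [ext_trivial_iff R P] at *
  obtain ⟨p, hp, hp0⟩ : ∃ p : P.complex.X 0 ⟶ X, Epi p ∧ P.complex.d 1 0 ≫ p = 0 :=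
    ⟨P.π.f 0, inferInstanceAs (Epi (P.π.f 0)), P.complex_d_comp_π_f_zero⟩
  obtain ⟨g, hg⟩ := h1 (p ≫ f) (by
    rw [← Category.assoc]; simp [hp0])
  rw [P.complex.shape _ _ (by simp)] at hg
  rw [← cancel_epi p]
  simp [← hg]

lemma ext_ses' (R : Type) [CommRing R] {X : ModuleCat R} (P : ProjectiveResolution X) (n : ℕ)
    (A B C : ModuleCat R) (f : A ⟶ B) (g : B ⟶ C) (w : f ≫ g = 0)
    (hS : (ShortComplex.mk f g w).ShortExact)
    (h1 : Subsingleton ↥(((Ext R (ModuleCat R) (n+1)).obj (Opposite.op X)).obj A))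
    (h2 : Subsingleton ↥(((Ext R (ModuleCat R) n).obj (Opposite.op X)).obj B)) :
    Subsingleton ↥(((Ext R (ModuleCat R) n).obj (Opposite.op X)).obj C) :=
  ext_ses R P n _ hS h1 h2

open CategoryTheory Module Pointwise in
lemma key_lemma (R : Type) [CommRing R] [IsNoetherianRing R] [IsLocalRing R] (n : ℕ) :
    ∀ (M : Type) [AddCommGroup M] [Module R M] [Module.Finite R M],
    (∀ j < n, Subsingleton (extC R j (R ⧸ IsLocalRing.maximalIdeal R) M)) →
    ∀ (N : Type) [AddCommGroup N] [Module R N] [Nontrivial N] (f : N →ₗ[R] M),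
    Function.Injective f → (n : WithBot ℕ∞) ≤ supportDim R N := by
  induction n with
  | zero =>
    intro M _ _ _ _ N _ _ _ f hf
    have h := supportDim_ne_bot_of_nontrivial R N
    obtain ⟨a, ha⟩ := WithBot.ne_bot_iff_exists.mp h
    rw [← ha]
    exact WithBot.coe_le_coe.mpr (by simp)
  | succ n ih =>
    intro M _ _ _ hM N _ _ _ f hf
    let P := projectiveResolution (ModuleCat.of R (R ⧸ IsLocalRing.maximalIdeal R))
    have h0 : Subsingleton ((R ⧸ IsLocalRing.maximalIdeal R) →ₗ[R] M) := by
      refine subsingleton_of_forall_eq 0 fun g => ?_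
      have := ext_zero R P (hM 0 (by omega)) (ModuleCat.ofHom g)
      exact congrArg ModuleCat.Hom.hom this
    obtain ⟨x, hx, hreg⟩ := IsSMulRegular.subsingleton_linearMap_iff.mp h0
    rw [Ideal.annihilator_quotient] at hx
    have hq : ∀ j < n, Subsingleton (extC R j (R ⧸ IsLocalRing.maximalIdeal R) (QuotSMulTop x M)) := by
      intro j hj
      exact ext_ses' R P j (ModuleCat.of R M) (ModuleCat.of R M) (ModuleCat.of R (QuotSMulTop x M))
        _ _ _ (IsSMulRegular.smulShortComplex_shortExact (M := ModuleCat.of R M) hreg)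
        (hM (j+1) (by omega)) (hM j (by omega))
    have hNM : IsNoetherian R M := inferInstance
    let a : ℕ →o Submodule R M := ⟨fun t => Submodule.comap (LinearMap.lsmul R M (x ^ t))
      (LinearMap.range f), by
        refine monotone_nat_of_le_succ fun t m hm => ?_
        simp only [Submodule.mem_comap, LinearMap.lsmul_apply] at hm ⊢
        rw [pow_succ', mul_smul]
        exact Submodule.smul_mem _ _ hm⟩
    obtain ⟨t, ht⟩ := monotone_stabilizes_iff_noetherian.mpr hNM a
    have hat : ∀ m, m ∈ a t ↔ x ^ t • m ∈ LinearMap.range f := fun m => Iff.rfl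
    have hsat : ∀ m, x • m ∈ a t → m ∈ a t := by
      intro m hm
      rw [ht (t+1) (by omega)]
      change x ^ (t+1) • m ∈ LinearMap.range f
      rw [pow_succ, mul_smul]
      exact hm
    have hregt : IsSMulRegular M (x ^ t) := hreg.pow t
    -- dimension of the saturation
    have hdim : supportDim R (a t) ≤ supportDim R N := by
      let e := LinearEquiv.ofInjective f hf
      rw [supportDim_eq_of_equiv e]
      let g : a t →ₗ[R] LinearMap.range f :=
        LinearMap.restrict (LinearMap.lsmul R M (x^t)) (fun m hm => hm)
      refine supportDim_le_of_injective g ?_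
      intro u v huv
      exact Subtype.ext (hregt (congrArg Subtype.val huv))
    have hnt : Nontrivial (a t) := by
      obtain ⟨y, hy⟩ := exists_ne (0 : N)
      refine ⟨⟨⟨f y, (hat _).2 (Submodule.smul_mem _ _ ⟨y, rfl⟩)⟩, 0, fun h => hy ?_⟩⟩
      exact hf (by simpa using congrArg Subtype.val h)
    have hregN : IsSMulRegular (a t) x := by
      intro u v huv
      exact Subtype.ext (hreg (congrArg Subtype.val huv))
    have hdim2 := supportDim_quotSMulTop_succ_eq_supportDim hregN hx
    have hntq : Nontrivial (QuotSMulTop x (a t)) := by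
      rw [← supportDim_ne_bot_iff_nontrivial R]
      intro h
      rw [h] at hdim2
      exact supportDim_ne_bot_of_nontrivial R (a t) (by rw [← hdim2]; rfl)
    let q : QuotSMulTop x (a t) →ₗ[R] QuotSMulTop x M := QuotSMulTop.map x (a t).subtype
    have hqinj : Function.Injective q := by
      rw [← LinearMap.ker_eq_bot, LinearMap.ker_eq_bot']
      intro u hu
      obtain ⟨u, rfl⟩ := Submodule.mkQ_surjective _ u
      have hu' : (u : M) ∈ x • (⊤ : Submodule R M) := by
        rw [← Submodule.ker_mkQ (x • (⊤ : Submodule R M))]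
        exact hu
      obtain ⟨v, -, hv⟩ := Submodule.mem_smul_pointwise_iff_exists _ _ _ |>.mp hu'
      have hv2 : v ∈ a t := hsat v (by rw [hv]; exact u.2)
      rw [Submodule.mkQ_apply, Submodule.Quotient.mk_eq_zero]
      exact Submodule.mem_smul_pointwise_iff_exists _ _ _ |>.mpr ⟨⟨v, hv2⟩, trivial, Subtype.ext hv⟩
    have := ih (QuotSMulTop x M) hq (QuotSMulTop x (a t)) q hqinj
    refine le_trans ?_ hdim
    rw [← hdim2]
    push_cast
    gcongr

open Module in
lemma mDim_le_of_cover {R : Type} [CommRing R] {M : Type} [AddCommGroup M] [Module R M]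
    (c : WithBot ℕ∞) (h : ∀ p ∈ Module.support R M, ∃ (N : Type) (_ : AddCommGroup N) (_ : Module R N),
      p ∈ Module.support R N ∧ mDim R N ≤ c) : mDim R M ≤ c := by
  refine iSup_le fun s => ?_
  obtain ⟨N, _, _, hp, hN⟩ := h s.head.1 s.head.2
  refine le_trans ?_ hN
  let s' : LTSeries (Module.support R N) :=
    { length := s.length
      toFun := fun i => ⟨(s i).1, Module.mem_support_mono (s.monotone (Fin.zero_le i)) hp⟩
      step := fun i => s.step i }
  exact le_iSup (fun p : LTSeries (Module.support R N) => (p.length : WithBot ℕ∞)) s'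

section mdim
variable {R : Type} [CommRing R] {M N Q : Type} [AddCommGroup M] [Module R M]
  [AddCommGroup N] [Module R N] [AddCommGroup Q] [Module R Q]

lemma mDim_inj (f : M →ₗ[R] N) (h : Function.Injective f) : mDim R M ≤ mDim R N :=
  Module.supportDim_le_of_injective f h
lemma mDim_surj (f : M →ₗ[R] N) (h : Function.Surjective f) : mDim R N ≤ mDim R M :=
  Module.supportDim_le_of_surjective f h
lemma mDim_equiv (e : M ≃ₗ[R] N) : mDim R M = mDim R N :=
  Module.supportDim_eq_of_equiv e
lemma mDim_bot_iff : mDim R M = ⊥ ↔ Subsingleton M :=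
  Module.supportDim_eq_bot_iff_subsingleton R M

lemma mDim_exact (f : N →ₗ[R] M) (g : M →ₗ[R] Q) (h : Function.Exact f g) (hf : Function.Injective f)
    (hg : Function.Surjective g) (c : WithBot ℕ∞) (h1 : mDim R N ≤ c) (h2 : mDim R Q ≤ c) :
    mDim R M ≤ c := by
  refine mDim_le_of_cover c fun p hp => ?_
  rw [Module.support_of_exact h hf hg] at hp
  rcases hp with hp | hp
  · exact ⟨N, _, _, hp, h1⟩
  · exact ⟨Q, _, _, hp, h2⟩

lemma mDim_quot (A : Submodule R M) (c : WithBot ℕ∞) (h1 : mDim R A ≤ c) (h2 : mDim R (M ⧸ A) ≤ c) :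
    mDim R M ≤ c :=
  mDim_exact A.subtype A.mkQ (LinearMap.exact_subtype_mkQ A) A.injective_subtype A.mkQ_surjective c h1 h2

/-- Dimension bound for an extension of submodules. -/
lemma mDim_subQuot {A B : Submodule R M} (c : WithBot ℕ∞) (hAB : A ≤ B) (h1 : mDim R A ≤ c)
    (h2 : mDim R (subQuot R A B) ≤ c) : mDim R B ≤ c := by
  refine mDim_quot (Submodule.comap B.subtype A) c ?_ h2
  rwa [mDim_equiv (Submodule.comapSubtypeEquivOfLe hAB)]

lemma mDim_deltaSub (c : ℕ) : mDim R (deltaSub R M c) ≤ c := by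
  refine mDim_le_of_cover _ fun p hp => ?_
  by_contra! hcon
  rw [← not_not (a := p ∈ _)] at hp
  apply hp
  rw [Module.notMem_support_iff']
  rintro ⟨m, hm⟩
  suffices h : ∃ r ∉ p.asIdeal, r • m = 0 by
    obtain ⟨r, hr, h⟩ := h
    exact ⟨r, hr, Subtype.ext h⟩
  unfold deltaSub at hm
  rw [sSup_eq_iSup'] at hm
  induction hm using Submodule.iSup_induction' with
  | mem N x hx =>
    have : p ∉ Module.support R N.1 := fun h => absurd N.2 (not_le.mpr (hcon N.1 _ _ h))
    rw [Module.notMem_support_iff'] at this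
    obtain ⟨r, hr, h⟩ := this ⟨x, hx⟩
    exact ⟨r, hr, congrArg Subtype.val h⟩
  | zero => exact ⟨1, p.isPrime.one_notMem, by simp⟩
  | add x y _ _ hx hy =>
    obtain ⟨r, hr, hx⟩ := hx
    obtain ⟨s, hs, hy⟩ := hy
    refine ⟨r * s, p.isPrime.mul_notMem hr hs, ?_⟩
    rw [smul_add, mul_smul, mul_smul, hy, smul_comm, hx]
    simp

lemma le_deltaSub {N : Submodule R M} (c : ℕ) (h : mDim R N ≤ c) : N ≤ deltaSub R M c :=
  le_sSup h

end mdim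

section cm
variable {R : Type} [CommRing R] 

open CategoryTheory in
lemma extC_equiv {A B C : Type} [AddCommGroup A] [Module R A] [AddCommGroup B] [Module R B]
    [AddCommGroup C] [Module R C] (j : ℕ) (e : B ≃ₗ[R] C) (h : Nontrivial (extC R j A B)) :
    Nontrivial (extC R j A C) := by
  let e' := ((Ext R (ModuleCat R) j).obj (Opposite.op (ModuleCat.of R A))).mapIso e.toModuleIso
  exact e'.toLinearEquiv.symm.toEquiv.nontrivial

lemma IsCM.equiv {I : Ideal R} {B C : Type} [AddCommGroup B] [Module R B]
    [AddCommGroup C] [Module R C] (e : B ≃ₗ[R] C) (h : IsCM R I B) : IsCM R I C := by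
  obtain ⟨h1, h2⟩ := h
  refine ⟨e.symm.toEquiv.nontrivial, ?_⟩
  have : mDepth R I C = mDepth R I B := by
    unfold mDepth
    congr 1
    ext i
    exact ⟨fun ⟨j, h, h'⟩ => ⟨j, h, extC_equiv j e.symm h'⟩, fun ⟨j, h, h'⟩ => ⟨j, h, extC_equiv j e h'⟩⟩
  rw [← mDim_equiv e, ← h2, this]

variable [IsNoetherianRing R] [IsLocalRing R] {M N : Type} [AddCommGroup M] [Module R M]
  [AddCommGroup N] [Module R N] [Module.Finite R M]

lemma depth_le [Nontrivial N] (f : N →ₗ[R] M) (hf : Function.Injective f) :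
    (mDepth R (IsLocalRing.maximalIdeal R) M : WithBot ℕ∞) ≤ mDim R N := by
  have h : ∀ n : ℕ, (n : ℕ∞) ≤ mDepth R (IsLocalRing.maximalIdeal R) M →
      (n : WithBot ℕ∞) ≤ mDim R N := by
    intro n hn
    refine key_lemma R n M ?_ N f hf
    intro j hj
    by_contra hc
    rw [not_subsingleton_iff_nontrivial] at hc
    have : mDepth R (IsLocalRing.maximalIdeal R) M ≤ (j : ℕ∞) := sInf_le ⟨j, rfl, hc⟩
    have := hn.trans this
    exact absurd (Nat.cast_le.mp this) (by omega)
  obtain ⟨a, ha⟩ := WithBot.ne_bot_iff_exists.mp (Module.supportDim_ne_bot_of_nontrivial R N)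
  change _ ≤ Module.supportDim R N
  change ∀ n : ℕ, (n : ℕ∞) ≤ mDepth R (IsLocalRing.maximalIdeal R) M →
      (n : WithBot ℕ∞) ≤ Module.supportDim R N at h
  rw [← ha] at h ⊢
  refine WithBot.coe_le_coe.mpr (ENat.forall_natCast_le_iff_le.mp fun n hn => ?_)
  exact WithBot.coe_le_coe.mp (h n hn)

lemma cm_map_eq_zero (hM : IsCM R (IsLocalRing.maximalIdeal R) M) (f : N →ₗ[R] M)
    (h : mDim R N < mDim R M) : f = 0 := by
  by_contra hf
  have : Nontrivial (LinearMap.range f) := by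
    rw [Submodule.nontrivial_iff_ne_bot]
    simpa [LinearMap.range_eq_bot] using hf
  have h1 := depth_le (LinearMap.range f).subtype (Submodule.injective_subtype _)
  rw [hM.2] at h1
  exact absurd (h1.trans (mDim_surj f.rangeRestrict f.surjective_rangeRestrict)) (not_le.mpr h)

lemma cm_of_dim_zero [Nontrivial M] (h : mDim R M ≤ 0) : IsCM R (IsLocalRing.maximalIdeal R) M := by
  refine ⟨inferInstance, le_antisymm (depth_le LinearMap.id Function.injective_id) (h.trans ?_)⟩
  exact WithBot.coe_le_coe.mpr (by simp)

lemma tors_eq : tors R (IsLocalRing.maximalIdeal R) M = deltaSub R M 0 := by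
  apply le_antisymm
  · refine iSup_le fun t => le_deltaSub 0 ?_
    have : Subsingleton (Module.support R (Submodule.torsionBySet R M
        ((IsLocalRing.maximalIdeal R ^ t : Ideal R) : Set R))) := by
      have key : ∀ p ∈ Module.support R (Submodule.torsionBySet R M
        ((IsLocalRing.maximalIdeal R ^ t : Ideal R) : Set R)), p.asIdeal = IsLocalRing.maximalIdeal R := by
        intro p hp
        have h1 := Module.annihilator_le_of_mem_support hp
        have h2 : IsLocalRing.maximalIdeal R ^ t ≤ p.asIdeal := by
          refine le_trans (fun r hr => ?_) h1
          rw [Module.mem_annihilator]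
          rintro ⟨m, hm⟩
          exact Subtype.ext ((Submodule.mem_torsionBySet_iff _ _).mp hm ⟨r, hr⟩)
        exact le_antisymm (IsLocalRing.le_maximalIdeal p.isPrime.ne_top)
          (p.isPrime.le_of_pow_le h2)
      exact ⟨fun a b => Subtype.ext (PrimeSpectrum.ext ((key a a.2).trans (key b b.2).symm))⟩
    exact Order.krullDim_nonpos_of_subsingleton
  · rcases subsingleton_or_nontrivial (deltaSub R M 0) with h | h
    · rw [Submodule.subsingleton_iff_eq_bot] at h
      rw [h]; exact bot_le
    have h0 : Module.supportDim R (deltaSub R M 0) = 0 := by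
      refine le_antisymm (mDim_deltaSub 0) ?_
      obtain ⟨a, ha⟩ := WithBot.ne_bot_iff_exists.mp
        (Module.supportDim_ne_bot_of_nontrivial R (deltaSub R M 0))
      rw [← ha]
      exact WithBot.coe_le_coe.mpr (by simp)
    have hs := support_of_supportDim_eq_zero R _ h0
    rw [Module.support_eq_zeroLocus, PrimeSpectrum.zeroLocus_eq_iff] at hs
    have hle : IsLocalRing.maximalIdeal R ≤ (Module.annihilator R (deltaSub R M 0)).radical := by
      rw [hs]; exact Ideal.le_radical
    obtain ⟨t, ht⟩ := Ideal.exists_pow_le_of_le_radical_of_fg hle (IsNoetherian.noetherian _)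
    refine le_trans (fun m hm => ?_) (le_iSup _ t)
    rw [Submodule.mem_torsionBySet_iff]
    rintro ⟨r, hr⟩
    exact congrArg Subtype.val (Module.mem_annihilator.mp (ht hr) ⟨m, hm⟩)

end cm

section fil
variable {R : Type} [CommRing R] {A B : Type} [AddCommGroup A] [Module R A]
  [AddCommGroup B] [Module R B]

lemma subQuot_comap (f : A →ₗ[R] B) (N N' : Submodule R B) (h : N' ≤ LinearMap.range f) :
    Nonempty (subQuot R (N.comap f) (N'.comap f) ≃ₗ[R] subQuot R N N') := by
  let g : N'.comap f →ₗ[R] N' := f.restrict (fun x hx => hx)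
  have hg : Function.Surjective g := by
    rintro ⟨y, hy⟩
    obtain ⟨x, rfl⟩ := h hy
    exact ⟨⟨x, hy⟩, rfl⟩
  let q := (Submodule.comap N'.subtype N).mkQ.comp g
  have hq : Function.Surjective q := (Submodule.mkQ_surjective _).comp hg
  have hk : Submodule.comap (N'.comap f).subtype (N.comap f) = LinearMap.ker q := by
    ext x
    simp only [q, LinearMap.ker_comp, Submodule.ker_mkQ]
    rfl
  exact ⟨(Submodule.quotEquivOfEq _ _ hk).trans (q.quotKerEquivOfSurjective hq)⟩

/-- Steps of a filtration. -/
def Step (R : Type) [CommRing R] (I : Ideal R) {M : Type} [AddCommGroup M] [Module R M]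
    (N N' : Submodule R M) : Prop := N < N' ∧ IsCM R I (subQuot R N N')

lemma Step.comap {I : Ideal R} (f : A →ₗ[R] B) {N N' : Submodule R B} (h : N' ≤ LinearMap.range f)
    (hs : Step R I N N') : Step R I (N.comap f) (N'.comap f) := by
  obtain ⟨e⟩ := subQuot_comap f N N' h
  refine ⟨lt_of_le_not_ge (Submodule.comap_mono hs.1.le) fun hle => hs.1.not_ge ?_, hs.2.equiv e.symm⟩
  intro y hy
  obtain ⟨x, rfl⟩ := h hy
  exact hle hy

lemma Step.of_comap {I : Ideal R} (f : A →ₗ[R] B) {N N' : Submodule R B} (h : N' ≤ LinearMap.range f)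
    (h0 : N ≤ LinearMap.range f)
    (hs : Step R I (N.comap f) (N'.comap f)) : Step R I N N' := by
  obtain ⟨e⟩ := subQuot_comap f N N' h
  have hle : N ≤ N' := by
    intro y hy
    obtain ⟨x, rfl⟩ := h0 hy
    exact hs.1.le hy
  exact ⟨lt_of_le_not_ge hle fun hle => hs.1.not_ge (Submodule.comap_mono hle), hs.2.equiv e⟩

lemma mDim_comap (f : A →ₗ[R] B) {N N' : Submodule R B} (h : N' ≤ LinearMap.range f) :
    mDim R (subQuot R (N.comap f) (N'.comap f)) = mDim R (subQuot R N N') := by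
  obtain ⟨e⟩ := subQuot_comap f N N' h
  exact mDim_equiv e

lemma isSCMFil_iff {I : Ideal R} (r : ℕ) (F : ℕ → Submodule R A) :
    IsSCMFil R I r F ↔ F 0 = ⊥ ∧ F r = ⊤ ∧ (∀ i < r, Step R I (F i) (F (i+1))) ∧
     (∀ i, i + 1 < r →
      mDim R (subQuot R (F i) (F (i + 1))) < mDim R (subQuot R (F (i + 1)) (F (i + 2)))) := by
  unfold IsSCMFil Step
  constructor
  · rintro ⟨a, b, c, d, e⟩
    exact ⟨a, b, fun i hi => ⟨c i hi, d i hi⟩, e⟩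
  · rintro ⟨a, b, c, e⟩
    exact ⟨a, b, fun i hi => (c i hi).1, fun i hi => (c i hi).2, e⟩

lemma fil_mono {I : Ideal R} {r : ℕ} {F : ℕ → Submodule R A} (h : IsSCMFil R I r F) {i j : ℕ}
    (hij : i ≤ j) (hj : j ≤ r) : F i ≤ F j := by
  induction j, hij using Nat.le_induction with
  | base => exact le_rfl
  | succ j hij ih => exact (ih (by omega)).trans (h.2.2.1 j (by omega)).le

lemma seqCM_sub {I : Ideal R} {r : ℕ} {F : ℕ → Submodule R A} (h : IsSCMFil R I r F) {j : ℕ}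
    (hj : j ≤ r) : IsSeqCM R I (F j) := by
  have hr : ∀ k ≤ j, F k ≤ LinearMap.range (F j).subtype := fun k hk => by
    rw [Submodule.range_subtype]; exact fil_mono h hk hj
  have h' := (isSCMFil_iff _ _).mp h
  refine ⟨j, fun k => (F k).comap (F j).subtype, (isSCMFil_iff _ _).mpr ⟨?_, ?_, ?_, ?_⟩⟩
  · simp [h'.1]
  · simp
  · exact fun i hi => (h'.2.2.1 i (by omega)).comap _ (hr _ (by omega))
  · intro i hi
    rw [mDim_comap _ (hr _ (by omega)), mDim_comap _ (hr _ (by omega))]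
    exact h'.2.2.2 i (by omega)

lemma seqCM_quot {I : Ideal R} {r : ℕ} {F : ℕ → Submodule R A} (h : IsSCMFil R I r F) {j : ℕ}
    (hj : j ≤ r) : IsSeqCM R I (A ⧸ F j) := by
  have hr : ∀ N : Submodule R (A ⧸ F j), N ≤ LinearMap.range (F j).mkQ := fun k => by simp
  have h' := (isSCMFil_iff _ _).mp h
  have hc : ∀ k, j + k ≤ r → ((F (j+k)).map (F j).mkQ).comap (F j).mkQ = F (j+k) := by
    intro k hk
    rw [Submodule.comap_map_mkQ, sup_eq_right]
    exact fil_mono h (by omega) hk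
  refine ⟨r - j, fun k => (F (j+k)).map (F j).mkQ, (isSCMFil_iff _ _).mpr ⟨?_, ?_, ?_, ?_⟩⟩
  · simp
  · simp [show j + (r - j) = r by omega, h'.2.1]
  · intro i hi
    refine Step.of_comap (F j).mkQ (hr _) (hr _) ?_
    rw [hc _ (by omega), hc _ (by omega)]
    exact h'.2.2.1 (j+i) (by omega)
  · intro i hi
    rw [← mDim_comap (F j).mkQ (hr _), ← mDim_comap (F j).mkQ (hr _), hc _ (by omega),
      hc _ (by omega), hc _ (by omega)]
    exact h'.2.2.2 (j+i) (by omega)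

lemma seqCM_glue {I : Ideal R} (D : Submodule R A) {s t : ℕ} {G : ℕ → Submodule R D}
    {H : ℕ → Submodule R (A ⧸ D)} (hG : IsSCMFil R I s G) (hH : IsSCMFil R I t H)
    (hb : ∀ i, i + 1 = s → 0 < t → mDim R (subQuot R (G i) (G (i+1))) <
      mDim R (subQuot R (H 0) (H 1))) : IsSeqCM R I A := by
  rw [isSCMFil_iff] at hG hH
  let F : ℕ → Submodule R A := fun k => if k ≤ s then (G k).map D.subtype else (H (k - s)).comap D.mkQ
  have hF1 : ∀ k ≤ s, F k = (G k).map D.subtype := fun k hk => by simp [F, hk]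
  have hF2 : ∀ k, F (s + k) = (H k).comap D.mkQ := fun k => by
    rcases Nat.eq_zero_or_pos k with rfl | hk
    · simp [hF1, hG.2.1, hH.1]
    · simp [F, show k ≠ 0 by omega]
  have hF3 : ∀ k ≤ s, (F k).comap D.subtype = G k := fun k hk => by
    rw [hF1 k hk, Submodule.comap_map_eq_of_injective D.injective_subtype]
  have hr : ∀ k ≤ s, F k ≤ LinearMap.range D.subtype := fun k hk => by
    rw [hF1 k hk]; exact LinearMap.map_le_range
  have hr2 : ∀ N : Submodule R (A ⧸ D), N ≤ LinearMap.range D.mkQ := fun k => by simp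
  have hd1 : ∀ k, k + 1 ≤ s → mDim R (subQuot R (F k) (F (k+1))) =
      mDim R (subQuot R (G k) (G (k+1))) := fun k hk => by
    rw [← mDim_comap D.subtype (hr _ hk), hF3 _ hk, hF3 _ (by omega)]
  have hd2 : ∀ k, mDim R (subQuot R (F (s+k)) (F (s+k+1))) =
      mDim R (subQuot R (H k) (H (k+1))) := fun k => by
    rw [add_assoc, hF2, hF2, mDim_comap D.mkQ (hr2 _)]
  refine ⟨s + t, F, (isSCMFil_iff _ _).mpr ⟨?_, ?_, ?_, ?_⟩⟩
  · rw [hF1 0 (by omega), hG.1]; simp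
  · rw [hF2, hH.2.1]; simp
  · intro i hi
    by_cases h : i + 1 ≤ s
    · refine Step.of_comap D.subtype (hr _ h) (hr _ (by omega)) ?_
      rw [hF3 _ h, hF3 _ (by omega)]
      exact hG.2.2.1 i (by omega)
    · obtain ⟨k, rfl⟩ := Nat.exists_eq_add_of_le (show s ≤ i by omega)
      rw [add_assoc, hF2, hF2]
      exact (hH.2.2.1 k (by omega)).comap _ (hr2 _)
  · intro i hi
    by_cases h : i + 2 ≤ s
    · rw [hd1 i (by omega), hd1 (i+1) h]
      exact hG.2.2.2 i (by omega)
    by_cases h : i + 1 = s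
    · rw [hd1 i (by omega)]
      have := hd2 0
      rw [add_zero, ← h] at this
      rw [this]
      exact hb i h (by omega)
    · obtain ⟨k, rfl⟩ := Nat.exists_eq_add_of_le (show s ≤ i by omega)
      have := hd2 (k+1)
      rw [← add_assoc] at this
      rw [hd2, this]
      exact hH.2.2.2 k (by omega)

lemma seqCM_of_delta {I : Ideal R} (c : ℕ) (h1 : IsSeqCM R I (deltaSub R A c))
    (h2 : IsSeqCM R I (A ⧸ deltaSub R A c)) : IsSeqCM R I A := by
  obtain ⟨s, G, hG⟩ := h1
  obtain ⟨t, H, hH⟩ := h2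
  refine seqCM_glue _ hG hH fun i hi ht => ?_
  have hle : mDim R (subQuot R (G i) (G (i+1))) ≤ c :=
    (mDim_surj (Submodule.mkQ _) (Submodule.mkQ_surjective _)).trans
      ((mDim_inj (Submodule.subtype _) (Submodule.injective_subtype _)).trans (mDim_deltaSub c))
  refine hle.trans_lt (not_le.mp fun hcon => ?_)
  have h0 := hH.2.2.1 0 ht
  have hd : mDim R (H 1) ≤ c := by
    refine mDim_subQuot _ h0.le ?_ hcon
    have : mDim R (H 0) = ⊥ := by
      rw [mDim_bot_iff, hH.1]; infer_instance
    rw [this]; exact bot_le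
  let D := deltaSub R A c
  have hD : D ≤ (H 1).comap D.mkQ := Submodule.le_comap_mkQ _ _
  have hd2 : mDim R ((H 1).comap D.mkQ) ≤ c := by
    refine mDim_subQuot (A := D) _ hD (mDim_deltaSub c) ?_
    have := mDim_comap D.mkQ (N := ⊥) (N' := H 1) (by simp)
    rw [Submodule.comap_bot, Submodule.ker_mkQ] at this
    rw [this]
    exact (mDim_surj (Submodule.mkQ _) (Submodule.mkQ_surjective _)).trans hd
  have h3 := le_deltaSub c hd2
  apply h0.not_ge
  intro y hy
  obtain ⟨y, rfl⟩ := D.mkQ_surjective y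
  have : y ∈ D := h3 hy
  rw [show D.mkQ y = 0 from (Submodule.Quotient.mk_eq_zero D (x := y)).mpr this]
  exact Submodule.zero_mem _

variable [IsNoetherianRing R] [IsLocalRing R] [Module.Finite R A]

lemma delta_eq {r : ℕ} {F : ℕ → Submodule R A} (h : IsSCMFil R (IsLocalRing.maximalIdeal R) r F)
    (c : ℕ) : ∃ j ≤ r, deltaSub R A c = F j := by
  classical
  let Pr : ℕ → Prop := fun j => ∀ k < j, mDim R (subQuot R (F k) (F (k+1))) ≤ c
  let j := Nat.findGreatest Pr r
  have hj : Pr j := Nat.findGreatest_spec (P := Pr) (Nat.zero_le r) (fun k hk => absurd hk (by omega))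
  have hjr : j ≤ r := Nat.findGreatest_le r
  refine ⟨j, hjr, le_antisymm ?_ ?_⟩
  · have hgt : ∀ k, j ≤ k → k < r → (c : WithBot ℕ∞) < mDim R (subQuot R (F k) (F (k+1))) := by
      intro k hk
      induction k, hk using Nat.le_induction with
      | base =>
        intro hjr'
        by_contra! hc
        refine Nat.findGreatest_is_greatest (P := Pr) (Nat.lt_succ_self j) hjr' ?_
        intro k hk
        rcases Nat.lt_succ_iff_lt_or_eq.mp hk with hk | rfl
        · exact hj k hk
        · exact hc
      | succ k hk ih =>
        intro hkr
        exact (ih (by omega)).trans (h.2.2.2.2 k hkr)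
    have hN := mDim_deltaSub (R := R) (M := A) c
    suffices hk : ∀ m, j + m ≤ r → deltaSub R A c ≤ F (r - m) by
      have := hk (r - j) (by omega)
      rwa [show r - (r - j) = j by omega] at this
    intro m
    induction m with
    | zero => intro _; simp [h.2.1]
    | succ m ih =>
      intro hm
      obtain ⟨k, hk⟩ : ∃ k, r - m = k + 1 := ⟨r - m - 1, by omega⟩
      have hle := ih (by omega)
      rw [hk] at hle
      rw [show r - (m+1) = k by omega]
      have hcm := h.2.2.2.1 k (by omega)
      have hz := cm_map_eq_zero hcm
        ((Submodule.mkQ (Submodule.comap (F (k+1)).subtype (F k))).comp (Submodule.inclusion hle))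
        (hN.trans_lt (hgt k (by omega) (by omega)))
      intro x hx
      have := LinearMap.congr_fun hz ⟨x, hx⟩
      simpa using this
  · apply le_deltaSub
    have : ∀ k ≤ j, mDim R (F k) ≤ c := by
      intro k
      induction k with
      | zero =>
        intro _
        have : mDim R (F 0) = ⊥ := by
          rw [mDim_bot_iff, h.1]; infer_instance
        rw [this]; exact bot_le
      | succ k ih =>
        intro hk
        exact mDim_subQuot _ (h.2.2.1 k (by omega)).le (ih (by omega)) (hj k (by omega))
    exact this j le_rfl

lemma seqCM_delta (h : IsSeqCM R (IsLocalRing.maximalIdeal R) A) (c : ℕ) :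
    IsSeqCM R (IsLocalRing.maximalIdeal R) (deltaSub R A c) ∧
    IsSeqCM R (IsLocalRing.maximalIdeal R) (A ⧸ deltaSub R A c) := by
  obtain ⟨r, F, hF⟩ := h
  obtain ⟨j, hj, e⟩ := delta_eq hF c
  rw [e]
  exact ⟨seqCM_sub hF hj, seqCM_quot hF hj⟩

lemma seqCM_of_dim_zero (h : mDim R A ≤ 0) : IsSeqCM R (IsLocalRing.maximalIdeal R) A := by
  rcases subsingleton_or_nontrivial A with hA | hA
  · exact ⟨0, fun _ => ⊥, rfl, Subsingleton.elim _ _, by simp, by simp, by simp⟩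
  · refine ⟨1, fun k => if k = 0 then ⊥ else ⊤, by simp, by simp, ?_, ?_, by simp⟩
    · intro i hi
      obtain rfl : i = 0 := by omega
      simp
    · intro i hi
      obtain rfl : i = 0 := by omega
      simp only [if_true, zero_add, one_ne_zero, if_false]
      have e : subQuot R (⊥ : Submodule R A) ⊤ ≃ₗ[R] A :=
        (Submodule.quotEquivOfEqBot _ (by simp [LinearMap.ker_eq_bot])).trans Submodule.topEquiv
      exact (cm_of_dim_zero h).equiv e.symm

end fil

open IsLocalRing in
/-- Let `M` be a `d`-dimensional finitely generated module over a Noetherian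
local ring `R`.  The following are equivalent: (1) `M` is sequentially Cohen-Macaulay;
(2) `δ_i(M)` and `M/δ_i(M)` are sequentially Cohen-Macaulay for all `0 ≤ i ≤ d`;
(3) there exists `0 ≤ i ≤ d` such that `δ_i(M)` and `M/δ_i(M)` are sequentially
Cohen-Macaulay.  In particular, `M` is sequentially Cohen-Macaulay if and only if
`M/H^0_𝔪(M)` is sequentially Cohen-Macaulay. -/
theorem stmt8 (R : Type) [CommRing R] [IsNoetherianRing R] [IsLocalRing R]
    (M : Type) [AddCommGroup M] [Module R M] [Module.Finite R M]
    (d : ℕ) (hd : mDim R M = (d : WithBot ℕ∞)) :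
    (IsSeqCM R (maximalIdeal R) M ↔
      ∀ i ≤ d, IsSeqCM R (maximalIdeal R) ↥(deltaSub R M i) ∧
        IsSeqCM R (maximalIdeal R) (M ⧸ deltaSub R M i)) ∧
    (IsSeqCM R (maximalIdeal R) M ↔
      ∃ i ≤ d, IsSeqCM R (maximalIdeal R) ↥(deltaSub R M i) ∧
        IsSeqCM R (maximalIdeal R) (M ⧸ deltaSub R M i)) ∧
    (IsSeqCM R (maximalIdeal R) M ↔
      IsSeqCM R (maximalIdeal R) (M ⧸ tors R (maximalIdeal R) M)) := by
  have h1 := fun i (h : IsSeqCM R (maximalIdeal R) M) => seqCM_delta h i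
  refine ⟨⟨fun h i _ => h1 i h, fun h => ?_⟩, ⟨fun h => ⟨0, Nat.zero_le _, h1 0 h⟩, ?_⟩, ?_⟩
  · exact seqCM_of_delta 0 (h 0 (Nat.zero_le _)).1 (h 0 (Nat.zero_le _)).2
  · rintro ⟨i, -, h, h'⟩
    exact seqCM_of_delta i h h'
  · rw [tors_eq]
    exact ⟨fun h => (h1 0 h).2, fun h => seqCM_of_delta 0 (seqCM_of_dim_zero (mDim_deltaSub 0)) h⟩
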